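/- The locally finite metric space (𝔷,ζ) does not uniformly embed into any metric space of non zero generalized roundness: if (B,d) is a metric space with 𝔮(B) > 0 (including 𝔮(B) = ∞), then there is no uniform embedding f : 𝔷 → B. -/

import Mathlib

/-- The cyclic metric with period `n^n`. -/
noncomputable def cyclicDist (n : ℕ) (a b : ℝ) : ℝ :=
  min |a - b| ((n : ℝ) ^ n - |a - b|)

/-- The set `L_n = {k·n^{-n} : 1 ≤ k ≤ n^{2n}}`. -/
def Ln (n : ℕ) : Set ℝ :=
  {a | ∃ k : ℕ, 1 ≤ k ∧ k ≤ n ^ (2 * n) ∧ a = (k : ℝ) / (n : ℝ) ^ n}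

/-- A copy of `M_n` (the product of `n^n` copies of `L_n`) realized as functions
`ℕ → ℝ` supported on the first `n^n` coordinates. -/
def MnF (n : ℕ) : Set (ℕ → ℝ) :=
  {x | (∀ i, i < n ^ n → x i ∈ Ln n) ∧ ∀ i, n ^ n ≤ i → x i = 0}

/-- The supremum metric on `MnF n`. -/
noncomputable def supDistF (n : ℕ) (x y : ℕ → ℝ) : ℝ :=
  ⨆ i : Fin (n ^ n), cyclicDist n (x i) (y i)

/-- The underlying set of the space `𝔷`: the disjoint union of the spaces `M_n`
over all (positive) even `n`, a point of `M_n` being recorded as a tag `n` together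
with a point of `MnF n`. -/
def ZSpace : Set (ℕ × (ℕ → ℝ)) :=
  {z | 0 < z.1 ∧ Even z.1 ∧ z.2 ∈ MnF z.1}

/-- The metric `ζ` on `𝔷`: it restricts to the supremum metric on each `M_n`, and
`ζ(x,y) = 4^{m+n}` if `x ∈ M_m`, `y ∈ M_n` with `m ≠ n`. -/
noncomputable def zeta (a b : ℕ × (ℕ → ℝ)) : ℝ :=
  if a.1 = b.1 then supDistF a.1 a.2 b.2 else 4 ^ (a.1 + b.1)

/-- The distance function of the metric space `(𝔷, ζ)`. -/
noncomputable def zetaDist (a b : ZSpace) : ℝ := zeta a.1 b.1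

/-- The set of exponents `p ≥ 0` for which the generalized roundness inequality holds in
the space with distance function `d`. -/
def grSet {X : Type*} (d : X → X → ℝ) : Set ℝ :=
  {p | 0 ≤ p ∧ ∀ n : ℕ, 2 ≤ n → ∀ x y : Fin n → X,
    (∑ i, ∑ j, if i < j then d (x i) (x j) ^ p + d (y i) (y j) ^ p else 0) ≤
      ∑ i, ∑ j, d (x i) (y j) ^ p}

/-- The generalized roundness `𝔮` of the space with distance function `d`,
valued in `ℝ≥0∞`. -/
noncomputable def genRoundness {X : Type*} (d : X → X → ℝ) : ENNReal :=
  sSup (ENNReal.ofReal '' grSet d)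
/-- `f` is a coarse embedding of the space with distance function `dX` into the space
with distance function `dY`: there are non-decreasing `ρ₁, ρ₂` with
`ρ₁(dX a b) ≤ dY (f a) (f b) ≤ ρ₂(dX a b)` and `ρ₁(t) → ∞` as `t → ∞`. -/
def IsCoarseEmbeddingWith {X Y : Type*} (dX : X → X → ℝ) (dY : Y → Y → ℝ)
    (f : X → Y) : Prop :=
  ∃ ρ₁ ρ₂ : ℝ → ℝ, Monotone ρ₁ ∧ Monotone ρ₂ ∧
    (∀ a b, ρ₁ (dX a b) ≤ dY (f a) (f b) ∧ dY (f a) (f b) ≤ ρ₂ (dX a b)) ∧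
    Filter.Tendsto ρ₁ Filter.atTop Filter.atTop

/-- `f` is a uniform embedding of the space with distance function `dX` into the space
with distance function `dY`: `f` is injective and both `f` and `f⁻¹` (on the range of
`f`) are uniformly continuous. -/
def IsUniformEmbeddingWith {X Y : Type*} (dX : X → X → ℝ) (dY : Y → Y → ℝ)
    (f : X → Y) : Prop :=
  Function.Injective f ∧
    (∀ ε : ℝ, 0 < ε → ∃ δ : ℝ, 0 < δ ∧ ∀ a b, dX a b < δ → dY (f a) (f b) < ε) ∧
    (∀ ε : ℝ, 0 < ε → ∃ δ : ℝ, 0 < δ ∧ ∀ a b, dY (f a) (f b) < δ → dX a b < ε)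

open Finset

theorem sum_sum_eq_two_mul_sum_lt {n : ℕ} (T : Fin n → Fin n → ℝ)
    (hsymm : ∀ i j, T i j = T j i) (hdiag : ∀ i, T i i = 0) :
    ∑ i, ∑ j, T i j = 2 * ∑ i, ∑ j, if i < j then T i j else 0 := by
  have h : ∀ i j, T i j = (if i < j then T i j else 0) + if j < i then T j i else 0 := by
    intro i j
    rcases lt_trichotomy i j with h | h | h
    · simp [h, h.not_gt]
    · subst h
      simp [hdiag]
    · simp [h, h.not_gt, hsymm i j]
  calc ∑ i, ∑ j, T i j
      = ∑ i, ∑ j, ((if i < j then T i j else 0) + if j < i then T j i else 0) :=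
        sum_congr rfl fun i _ => sum_congr rfl fun j _ => h i j
    _ = _ := by
        simp only [sum_add_distrib]
        rw [two_mul]
        congr 1
        rw [sum_comm]

/-- The generalized roundness inequality for two families indexed by a finite type, the sums
running over all ordered pairs. -/
theorem sum_rpow_dist_le_of_mem_grSet {B : Type*} [MetricSpace B] {p : ℝ} (hp : 0 < p)
    (hmem : p ∈ grSet (dist : B → B → ℝ)) {α : Type*} [Fintype α] (hα : 2 ≤ Fintype.card α)
    (u v : α → B) :
    ∑ a, ∑ b, (dist (u a) (u b) ^ p + dist (v a) (v b) ^ p) ≤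
      2 * ∑ a, ∑ b, dist (u a) (v b) ^ p := by
  let e := (Fintype.equivFin α).symm
  have h := hmem.2 _ hα (u ∘ e) (v ∘ e)
  have h2 := sum_sum_eq_two_mul_sum_lt
    (fun i j => dist ((u ∘ e) i) ((u ∘ e) j) ^ p + dist ((v ∘ e) i) ((v ∘ e) j) ^ p)
    (fun i j => by simp only [dist_comm]) (fun i => by simp [hp.ne'])
  have h3 : ∀ T : α → α → ℝ, ∑ a, ∑ b, T a b = ∑ i, ∑ j, T (e i) (e j) := fun T => by
    rw [← e.sum_comp]
    exact sum_congr rfl fun i _ => (e.sum_comp _).symm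
  rw [h3, h3]
  simp only [Function.comp_apply] at h h2
  linarith

/-- The translation-averaged kernel pulled back along a map from a finite group is of negative
type. -/
theorem sum_translates_le_of_mem_grSet {B : Type*} [MetricSpace B] {p : ℝ} (hp : 0 < p)
    (hmem : p ∈ grSet (dist : B → B → ℝ)) {G : Type*} [AddCommGroup G] [Fintype G]
    (φ : G → B) {α : Type*} [Fintype α] (hα : 2 ≤ Fintype.card α) (u v : α → G) :
    ∑ a, ∑ b, (∑ g, dist (φ g) (φ (g + (u a - u b))) ^ p +
        ∑ g, dist (φ g) (φ (g + (v a - v b))) ^ p) ≤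
      2 * ∑ a, ∑ b, ∑ g, dist (φ g) (φ (g + (u a - v b))) ^ p := by
  have key : ∀ s t : G, ∑ g, dist (φ g) (φ (g + (s - t))) ^ p =
      ∑ g, dist (φ (g + s)) (φ (g + t)) ^ p := fun s t => by
    rw [← Equiv.sum_comp (Equiv.addRight t)]
    refine sum_congr rfl fun g _ => ?_
    rw [dist_comm]
    simp [add_assoc]
  have h := sum_le_sum fun g (_ : g ∈ univ) => sum_rpow_dist_le_of_mem_grSet hp hmem hα
    (fun a => φ (g + u a)) (fun a => φ (g + v a))
  have swap : ∀ T : G → α → α → ℝ, ∑ g, ∑ a, ∑ b, T g a b = ∑ a, ∑ b, ∑ g, T g a b := fun T => by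
    rw [sum_comm]
    exact sum_congr rfl fun a _ => sum_comm
  simp only [key]
  rw [← mul_sum, swap, swap] at h
  simpa only [sum_add_distrib] using h

/-- The integral of `F` with respect to the power of a weight `w`. -/
def piSum {ι Y : Type*} [Fintype ι] [DecidableEq ι] [Fintype Y] (w : Y → ℝ)
    (F : (ι → Y) → ℝ) : ℝ :=
  ∑ z : ι → Y, (∏ i, w (z i)) * F z

theorem piSum_comp {ι Y Z : Type*} [Fintype ι] [DecidableEq ι] [Fintype Y] [Fintype Z]
    [DecidableEq Y] (ω : Z → ℝ) (w : Y → ℝ) (g : Z → Y)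
    (h : ∀ y, ∑ z, (if g z = y then ω z else 0) = w y) (F : (ι → Y) → ℝ) :
    piSum ω (fun z => F (fun i => g (z i))) = piSum w F := by
  unfold piSum
  have hw : ∀ ε : ι → Y, ∏ i, w (ε i) =
      ∑ z : ι → Z, if (fun i => g (z i)) = ε then ∏ i, ω (z i) else 0 := fun ε => by
    simp only [← h]
    rw [prod_univ_sum, Fintype.piFinset_univ]
    refine sum_congr rfl fun z _ => ?_
    rw [prod_ite_zero]
    simp [funext_iff]
  simp only [hw, sum_mul]
  rw [sum_comm]
  refine sum_congr rfl fun z _ => ?_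
  simp [ite_mul]

theorem piSum_mono {ι Y : Type*} [Fintype ι] [DecidableEq ι] [Fintype Y] {w : Y → ℝ}
    (hw : ∀ y, 0 ≤ w y) {F F' : (ι → Y) → ℝ} (h : ∀ z, F z ≤ F' z) :
    piSum w F ≤ piSum w F' :=
  sum_le_sum fun z _ => mul_le_mul_of_nonneg_left (h z) (prod_nonneg fun _ _ => hw _)

theorem piSum_const {ι Y : Type*} [Fintype ι] [DecidableEq ι] [Fintype Y] {w : Y → ℝ}
    (hw : ∑ y, w y = 1) (C : ℝ) : piSum w (fun _ : ι → Y => C) = C := by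
  have h := prod_univ_sum (fun _ : ι => (univ : Finset Y)) (fun _ y => w y)
  rw [Fintype.piFinset_univ] at h
  rw [piSum, ← sum_mul, ← h]
  simp [hw]

/-- The law of a random element of `{-1, 0, 1}` that is nonzero with probability `q` and has a
uniformly distributed sign. -/
noncomputable def lazySign (q : ℝ) (s : SignType) : ℝ :=
  if s = 0 then 1 - q else q / 2

theorem sum_signType (f : SignType → ℝ) : ∑ s, f s = f 0 + f (-1) + f 1 := by
  have : (univ : Finset SignType) = {0, -1, 1} := rfl
  rw [this, sum_insert (by decide), sum_insert (by decide), sum_singleton, add_assoc]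

theorem lazySign_nonneg {q : ℝ} (h0 : 0 ≤ q) (h1 : q ≤ 1) (s : SignType) : 0 ≤ lazySign q s := by
  unfold lazySign
  split_ifs <;> linarith

theorem sum_lazySign (q : ℝ) : ∑ s, lazySign q s = 1 := by
  rw [sum_signType]
  simp only [lazySign]
  norm_num
  ring

/-- The sign encoded by a Boolean. -/
def boolSign (b : Bool) : SignType := if b then 1 else -1

/-- Half of the difference of two signs. -/
def halfDiff (a b : Bool) : SignType := if a = b then 0 else boolSign a

/-- The law `lazySign q` together with two independent uniform Booleans. -/
noncomputable def lazySignBool (q : ℝ) (z : SignType × Bool × Bool) : ℝ := lazySign q z.1 / 4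

theorem lazySignBool_cross (q : ℝ) (y : SignType) :
    ∑ z : SignType × Bool × Bool, (if (if z.1 = 1 then boolSign z.2.1 else
      if z.1 = -1 then -boolSign z.2.2 else 0) = y then lazySignBool q z else 0) =
        lazySign q y := by
  simp only [Fintype.sum_prod_type, sum_signType, Fintype.sum_bool, lazySignBool, lazySign,
    boolSign]
  cases y <;> simp <;> ring

theorem lazySignBool_same (q : ℝ) (s : SignType) (hs : s ≠ 0) (y : SignType) :
    ∑ z : SignType × Bool × Bool, (if (if z.1 = s then halfDiff z.2.1 z.2.2 else 0) = y
      then lazySignBool q z else 0) = lazySign (q / 4) y := by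
  simp only [Fintype.sum_prod_type, sum_signType, Fintype.sum_bool, lazySignBool, lazySign,
    boolSign, halfDiff]
  cases s <;> cases y <;> simp at hs ⊢ <;> ring

theorem piSum_lazySignBool {ι : Type*} [Fintype ι] [DecidableEq ι] (q : ℝ)
    (F : (ι → SignType × Bool × Bool) → ℝ) :
    piSum (lazySignBool q) F = ∑ c : ι → SignType, (∏ i, lazySignBool q (c i, false, false)) *
      ∑ a : ι → Bool, ∑ b : ι → Bool, F (fun i => (c i, a i, b i)) := by
  let e : (ι → SignType × Bool × Bool) ≃ (ι → SignType) × (ι → Bool) × (ι → Bool) :=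
    { toFun := fun z => (fun i => (z i).1, fun i => (z i).2.1, fun i => (z i).2.2)
      invFun := fun w i => (w.1 i, w.2.1 i, w.2.2 i)
      left_inv := fun _ => rfl
      right_inv := fun _ => rfl }
  rw [piSum, ← e.symm.sum_comp, Fintype.sum_prod_type]
  refine sum_congr rfl fun c _ => ?_
  rw [Fintype.sum_prod_type, mul_sum]
  refine sum_congr rfl fun a _ => ?_
  rw [mul_sum]
  rfl

section Doubling

variable {ι A : Type*} [Fintype ι] [DecidableEq ι] [CommRing A]

/-- The vector with entries `r` times the given signs. -/
def signVec (r : A) (ε : ι → SignType) : ι → A := fun i => r * (ε i : A)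

/-- Doubling the scale while dividing the density by four does not increase the average of a
function of negative type. -/
theorem piSum_lazySign_doubling [Nonempty ι] (k : (ι → A) → ℝ)
    (hk : ∀ u v : (ι → Bool) → ι → A, ∑ a, ∑ b, (k (u a - u b) + k (v a - v b)) ≤
      2 * ∑ a, ∑ b, k (u a - v b)) {q : ℝ} (h0 : 0 ≤ q) (h1 : q ≤ 1) (r : A) :
    piSum (lazySign (q / 4)) (fun ε : ι → SignType => k (signVec (2 * r) ε)) ≤
      piSum (lazySign q) (fun ε : ι → SignType => k (signVec r ε)) := by
  have hx := piSum_comp (ι := ι) _ _ _ (lazySignBool_same q 1 (by decide))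
    (fun ε => k (signVec (2 * r) ε))
  have hy := piSum_comp (ι := ι) _ _ _ (lazySignBool_same q (-1) (by decide))
    (fun ε => k (signVec (2 * r) ε))
  have hxy := piSum_comp (ι := ι) _ _ _ (lazySignBool_cross q) (fun ε => k (signVec r ε))
  rw [piSum_lazySignBool] at hx hy hxy
  have hle := sum_le_sum fun (c : ι → SignType) (_ : c ∈ univ) => mul_le_mul_of_nonneg_left
    (hk (fun a i => r * ((if c i = 1 then boolSign (a i) else 0 : SignType) : A))
      (fun a i => r * ((if c i = -1 then boolSign (a i) else 0 : SignType) : A)))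
    (prod_nonneg fun i _ => div_nonneg (lazySign_nonneg h0 h1 (c i)) (by norm_num) :
      0 ≤ ∏ i, lazySignBool q (c i, false, false))
  have hu : ∀ (s : SignType) (c : ι → SignType) (a b : ι → Bool),
      ((fun i => r * ((if c i = s then boolSign (a i) else 0 : SignType) : A)) -
        fun i => r * ((if c i = s then boolSign (b i) else 0 : SignType) : A)) =
      signVec (2 * r) fun i => if c i = s then halfDiff (a i) (b i) else 0 := by
    intro s c a b
    funext i
    simp only [Pi.sub_apply, signVec]
    by_cases h : c i = s
    · cases a i <;> cases b i <;> simp [h, boolSign, halfDiff] <;> ring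
    · simp [h]
  have hv : ∀ (c : ι → SignType) (a b : ι → Bool),
      ((fun i => r * ((if c i = 1 then boolSign (a i) else 0 : SignType) : A)) -
        fun i => r * ((if c i = -1 then boolSign (b i) else 0 : SignType) : A)) =
      signVec r fun i => if c i = 1 then boolSign (a i) else
        if c i = -1 then -boolSign (b i) else 0 := by
    intro c a b
    funext i
    simp only [Pi.sub_apply, signVec]
    cases c i <;> cases a i <;> cases b i <;> simp [boolSign]
  simp only [hu, hv, mul_left_comm _ (2 : ℝ), sum_add_distrib, mul_add] at hle
  rw [← mul_sum] at hle
  linarith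

theorem piSum_lazySign_iterate [Nonempty ι] (k : (ι → A) → ℝ)
    (hk : ∀ u v : (ι → Bool) → ι → A, ∑ a, ∑ b, (k (u a - u b) + k (v a - v b)) ≤
      2 * ∑ a, ∑ b, k (u a - v b)) (r : A) (t : ℕ) :
    piSum (lazySign ((1 / 4) ^ t)) (fun ε : ι → SignType => k (signVec (2 ^ t * r) ε)) ≤
      piSum (lazySign 1) (fun ε : ι → SignType => k (signVec r ε)) := by
  induction t with
  | zero => simp
  | succ t ih =>
    refine le_trans ?_ ih
    have h := piSum_lazySign_doubling k hk (q := (1 / 4) ^ t) (by positivity)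
      (pow_le_one₀ (by norm_num) (by norm_num)) (2 ^ t * r)
    rwa [← mul_assoc, ← pow_succ', div_eq_mul_one_div, ← pow_succ] at h

end Doubling

theorem le_piSum_lazySign {ι : Type*} [Fintype ι] [DecidableEq ι] {q : ℝ} (h0 : 0 ≤ q)
    (h1 : q ≤ 1) {C : ℝ} {F : (ι → SignType) → ℝ} (hF0 : 0 ≤ F 0)
    (hF : ∀ ε, ε ≠ 0 → C ≤ F ε) :
    (1 - (1 - q) ^ Fintype.card ι) * C ≤ piSum (lazySign q) F := by
  have h := piSum_mono (ι := ι) (w := lazySign q) (lazySign_nonneg h0 h1)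
    (F := fun ε => C - if ε = 0 then C else 0) (F' := F) (fun ε => by
      by_cases hε : ε = 0
      · simp [hε, hF0]
      · simp [hε, hF ε hε])
  refine le_trans (le_of_eq ?_) h
  have h2 := piSum_const (ι := ι) (sum_lazySign q) C
  simp only [piSum, mul_sub, sum_sub_distrib] at h2 ⊢
  rw [h2]
  simp [lazySign, sub_mul]

section Embedding

variable {n : ℕ}

/-- The point of `L_n` corresponding to a residue modulo `n ^ (2 * n)`. -/
noncomputable def residuePoint (n : ℕ) (a : ZMod (n ^ (2 * n))) : ℝ :=
  ((a.val + 1 : ℕ) : ℝ) / (n : ℝ) ^ n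

theorem cyclicDist_comm (n : ℕ) (a b : ℝ) : cyclicDist n a b = cyclicDist n b a := by
  simp only [cyclicDist, abs_sub_comm]

theorem cyclicDist_residuePoint_add (hn : 0 < n) (a : ZMod (n ^ (2 * n))) {r : ℕ}
    (hr : 2 * r ≤ n ^ (2 * n)) :
    cyclicDist n (residuePoint n a) (residuePoint n (a + r)) = r / (n : ℝ) ^ n := by
  have hN : 0 < n ^ (2 * n) := by positivity
  have : NeZero (n ^ (2 * n)) := ⟨hN.ne'⟩
  have hM : (0 : ℝ) < (n : ℝ) ^ n := by positivity
  have hval : (r : ZMod (n ^ (2 * n))).val = r := ZMod.val_cast_of_lt (by omega)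
  have hNM : ((n ^ (2 * n) : ℕ) : ℝ) = (n : ℝ) ^ n * (n : ℝ) ^ n := by
    push_cast
    rw [← pow_add, two_mul]
  have hr' : 2 * (r : ℝ) ≤ (n : ℝ) ^ n * (n : ℝ) ^ n := by
    rw [← hNM]
    exact_mod_cast hr
  have hle : (r : ℝ) / (n : ℝ) ^ n ≤ (n : ℝ) ^ n - r / (n : ℝ) ^ n := by
    rw [le_sub_iff_add_le, ← add_div, div_le_iff₀ hM]
    linarith
  have h0 : (0 : ℝ) ≤ r / (n : ℝ) ^ n := by positivity
  unfold cyclicDist residuePoint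
  rcases lt_or_ge (a.val + r) (n ^ (2 * n)) with h | h
  · rw [ZMod.val_add_of_lt (by rwa [hval]), hval, ← sub_div]
    have : ((a.val + 1 : ℕ) : ℝ) - ((a.val + r + 1 : ℕ) : ℝ) = -r := by
      push_cast
      ring
    rw [this, neg_div, abs_neg, abs_of_nonneg h0, min_eq_left hle]
  · have hv := ZMod.val_add_val_of_le (a := a) (b := (r : ZMod (n ^ (2 * n)))) (by rwa [hval])
    rw [hval] at hv
    have hv' : (a.val : ℝ) + r = (a + r).val + (n : ℝ) ^ n * (n : ℝ) ^ n := by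
      rw [← hNM]
      exact_mod_cast hv
    rw [← sub_div]
    have : (((a.val + 1 : ℕ) : ℝ) - (((a + r).val + 1 : ℕ) : ℝ)) / (n : ℝ) ^ n =
        (n : ℝ) ^ n - r / (n : ℝ) ^ n := by
      field_simp
      push_cast
      linarith
    rw [this, abs_of_nonneg (h0.trans hle), sub_sub_cancel, min_eq_right hle]

theorem cyclicDist_self (n : ℕ) (a : ℝ) : cyclicDist n a a = 0 := by
  simp [cyclicDist]

theorem cyclicDist_residuePoint_add_sign (hn : 0 < n) (a : ZMod (n ^ (2 * n))) {r : ℕ}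
    (hr : 2 * r ≤ n ^ (2 * n)) (s : SignType) :
    cyclicDist n (residuePoint n a) (residuePoint n (a + r * (s : ZMod (n ^ (2 * n))))) =
      if s = 0 then 0 else r / (n : ℝ) ^ n := by
  cases s
  · simp [cyclicDist_self n]
  · have h := cyclicDist_residuePoint_add hn (a - r) hr
    rw [cyclicDist_comm] at h
    simpa [sub_eq_add_neg] using h
  · simpa using cyclicDist_residuePoint_add hn a hr

theorem residuePoint_mem_Ln (hn : 0 < n) (a : ZMod (n ^ (2 * n))) : residuePoint n a ∈ Ln n := by
  have : NeZero (n ^ (2 * n)) := ⟨by positivity⟩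
  exact ⟨a.val + 1, by omega, a.val_lt, rfl⟩

/-- The point of `M_n` with given residues as coordinates. -/
noncomputable def gridPoint (hn : 0 < n) (he : Even n) (x : Fin (n ^ n) → ZMod (n ^ (2 * n))) :
    ZSpace :=
  ⟨(n, fun i => if h : i < n ^ n then residuePoint n (x ⟨i, h⟩) else 0), hn, he,
    fun i hi => by simpa [hi] using residuePoint_mem_Ln hn _,
    fun i hi => by simp [hi.not_gt]⟩

theorem zetaDist_gridPoint (hn : 0 < n) (he : Even n) (x y : Fin (n ^ n) → ZMod (n ^ (2 * n))) :
    zetaDist (gridPoint hn he x) (gridPoint hn he y) =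
      ⨆ i, cyclicDist n (residuePoint n (x i)) (residuePoint n (y i)) := by
  simp [zetaDist, zeta, gridPoint, supDistF]

theorem zetaDist_gridPoint_add_le (hn : 0 < n) (he : Even n)
    (x : Fin (n ^ n) → ZMod (n ^ (2 * n))) {r : ℕ} (hr : 2 * r ≤ n ^ (2 * n))
    (ε : Fin (n ^ n) → SignType) :
    zetaDist (gridPoint hn he x) (gridPoint hn he (x + signVec (r : ZMod (n ^ (2 * n))) ε)) ≤
      r / (n : ℝ) ^ n := by
  have : NeZero (n ^ n) := ⟨by positivity⟩
  rw [zetaDist_gridPoint]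
  refine ciSup_le fun i => ?_
  rw [Pi.add_apply, signVec, cyclicDist_residuePoint_add_sign hn _ hr]
  split_ifs
  · positivity
  · rfl

theorem le_zetaDist_gridPoint_add (hn : 0 < n) (he : Even n)
    (x : Fin (n ^ n) → ZMod (n ^ (2 * n))) {r : ℕ} (hr : 2 * r ≤ n ^ (2 * n))
    {ε : Fin (n ^ n) → SignType} (hε : ε ≠ 0) :
    r / (n : ℝ) ^ n ≤
      zetaDist (gridPoint hn he x)
        (gridPoint hn he (x + signVec (r : ZMod (n ^ (2 * n))) ε)) := by
  obtain ⟨i, hi⟩ := Function.ne_iff.1 hε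
  rw [zetaDist_gridPoint]
  refine le_ciSup_of_le (Set.finite_range _).bddAbove i ?_
  rw [Pi.add_apply, signVec, cyclicDist_residuePoint_add_sign hn _ hr, if_neg (by simpa using hi)]

end Embedding

theorem exists_pos_mem_grSet {X : Type*} {d : X → X → ℝ} (h : 0 < genRoundness d) :
    ∃ p ∈ grSet d, 0 < p := by
  obtain ⟨_, ⟨p, hp, rfl⟩, hpos⟩ := lt_sSup_iff.1 h
  exact ⟨p, hp, ENNReal.ofReal_pos.1 hpos⟩

/-- There are arbitrarily large grids whose mesh is compatible with a subdivision of the unit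
length into `2 ^ t` parts. -/
theorem exists_even_pow_self_eq (t : ℕ) {q : ℝ} (h0 : 0 < q) (h1 : q ≤ 1) :
    ∃ n r : ℕ, 0 < n ∧ Even n ∧ n ^ n = 2 ^ t * r ∧ 2 * n ^ n ≤ n ^ (2 * n) ∧
      (1 - q) ^ (n ^ n) ≤ 1 / 2 := by
  obtain ⟨m, hm⟩ := exists_pow_lt_of_lt_one (by norm_num : (0 : ℝ) < 1 / 2)
    (by linarith : 1 - q < 1)
  let l := m + t + 1
  have hl : l < 2 ^ l := Nat.lt_two_pow_self
  have hpow : ((2 ^ l) ^ (2 ^ l) : ℕ) = 2 ^ (l * 2 ^ l) := (pow_mul 2 l _).symm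
  have hl2 : l ≤ l * 2 ^ l := Nat.le_mul_of_pos_right _ (by positivity)
  have hl3 : 2 ^ l ≤ 2 ^ (l * 2 ^ l) := Nat.pow_le_pow_right (by norm_num) hl2
  refine ⟨2 ^ l, 2 ^ (l * 2 ^ l - t), by positivity, ⟨2 ^ (m + t), ?_⟩, ?_, ?_, ?_⟩
  · rw [← two_mul, ← pow_succ']
  · rw [hpow, ← pow_add]
    congr 1
    omega
  · rw [two_mul (2 ^ l), pow_add (2 ^ l), hpow]
    refine Nat.mul_le_mul_right _ ?_
    omega
  · refine le_trans (pow_le_pow_of_le_one (by linarith) (by linarith) ?_) hm.le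
    rw [hpow]
    omega

/-- Theorem 3 of the paper: the locally finite metric space `(𝔷, ζ)`
does not uniformly embed into any metric space of non zero generalized roundness. -/
theorem Z_not_uniformly_embeddable {B : Type*} [MetricSpace B]
    (hB : 0 < genRoundness (dist : B → B → ℝ)) (f : ZSpace → B) :
    ¬ IsUniformEmbeddingWith zetaDist (dist : B → B → ℝ) f := by
  rintro ⟨-, huc, hinv⟩
  obtain ⟨p, hmem, hp⟩ := exists_pos_mem_grSet hB
  obtain ⟨δ, hδ, hfar⟩ := hinv 1 one_pos
  have hc : 0 < δ ^ p := Real.rpow_pos_of_pos hδ p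
  obtain ⟨η, hη, hnear⟩ := huc ((δ ^ p / 4) ^ p⁻¹) (by positivity)
  obtain ⟨t, ht⟩ := exists_pow_lt_of_lt_one hη (by norm_num : (1 / 2 : ℝ) < 1)
  have hq0 : (0 : ℝ) < (1 / 4) ^ t := by positivity
  have hq1 : (1 / 4 : ℝ) ^ t ≤ 1 := pow_le_one₀ (by norm_num) (by norm_num)
  obtain ⟨n, r, hn, he, hnr, hN, hdim⟩ := exists_even_pow_self_eq t hq0 hq1
  have hne : NeZero (n ^ n) := ⟨by positivity⟩
  have hNe : NeZero (n ^ (2 * n)) := ⟨by positivity⟩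
  have hM : (0 : ℝ) < (n : ℝ) ^ n := by positivity
  have hrM : r ≤ n ^ n := hnr ▸ Nat.le_mul_of_pos_left r (by positivity)
  have hrη : (r : ℝ) / (n : ℝ) ^ n < η := by
    refine lt_of_eq_of_lt ?_ ht
    have h : (n : ℝ) ^ n = 2 ^ t * r := by exact_mod_cast hnr
    rw [div_eq_iff hM.ne', h, ← mul_assoc, ← mul_pow]
    norm_num
  let φ := fun x : Fin (n ^ n) → ZMod (n ^ (2 * n)) => f (gridPoint hn he x)
  let k := fun h => ∑ g, dist (φ g) (φ (g + h)) ^ p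
  have hcard : 2 ≤ Fintype.card (Fin (n ^ n) → Bool) := by
    simpa using Nat.le_self_pow hne.ne 2
  have hiter := piSum_lazySign_iterate k
    (sum_translates_le_of_mem_grSet hp hmem φ hcard) (r : ZMod (n ^ (2 * n))) t
  set m : ℝ := (Fintype.card (Fin (n ^ n) → ZMod (n ^ (2 * n))) : ℝ) with hm
  have hm0 : 0 < m := by
    rw [hm]
    exact_mod_cast Fintype.card_pos
  have hupper : ∀ ε, k (signVec (r : ZMod (n ^ (2 * n))) ε) ≤ m * (δ ^ p / 4) := fun ε => by
    rw [hm, ← nsmul_eq_mul]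
    refine sum_le_card_nsmul _ _ _ fun g _ => ?_
    have h := hnear _ _
      ((zetaDist_gridPoint_add_le hn he g (r := r) (by omega) ε).trans_lt hrη)
    refine (Real.rpow_le_rpow dist_nonneg h.le hp.le).trans_eq ?_
    rw [← Real.rpow_mul (by positivity), inv_mul_cancel₀ hp.ne', Real.rpow_one]
  have hscale : (2 ^ t * r : ZMod (n ^ (2 * n))) = ((n ^ n : ℕ) : ZMod (n ^ (2 * n))) := by
    rw [hnr]
    push_cast
    rfl
  have hlower : ∀ ε, ε ≠ 0 → m * δ ^ p ≤ k (signVec (2 ^ t * r : ZMod (n ^ (2 * n))) ε) :=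
    fun ε hε => by
    rw [hm, ← nsmul_eq_mul, hscale]
    refine card_nsmul_le_sum _ _ _ fun g _ => ?_
    refine Real.rpow_le_rpow hδ.le ?_ hp.le
    by_contra! hlt
    have h1 := hfar _ _ hlt
    have h2 := le_zetaDist_gridPoint_add hn he g hN hε
    push_cast at h1 h2
    rw [div_self hM.ne'] at h2
    linarith
  have hU := piSum_mono (lazySign_nonneg zero_le_one le_rfl) hupper
  rw [piSum_const (sum_lazySign 1)] at hU
  have hL := le_piSum_lazySign hq0.le hq1 (sum_nonneg fun g _ => by positivity) hlower
  rw [Fintype.card_fin] at hL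
  nlinarith [mul_pos hm0 hc]
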